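/- arXiv:math/0408076 — 2 statements merged into one kernel-verified Lean document; each statement's English description precedes it below -/
import Mathlib

section
/- If N×N commuting extensions of the n×n matrices A_1,...,A_d exist, then N ≥ n + (1/2)·max_{i,j} rank([A_i,A_j]), where [A,B] = AB − BA. -/
/-- if N×N commuting extensions of the n×n matrices A_i exist, then
`N ≥ n + (1/2) max_{i,j} rank [A_i, A_j]`, stated as `2n + rank [A_i,A_j] ≤ 2N` for all i, j. -/
theorem commuting_extensions_size_lower_bound {F : Type*} [Field F]
    (d n N : ℕ) (hnN : n ≤ N)
    (A : Fin d → Matrix (Fin n) (Fin n) F)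
    (Atil : Fin d → Matrix (Fin N) (Fin N) F)
    (hext : ∀ i, (Atil i).submatrix (Fin.castLE hnN) (Fin.castLE hnN) = A i)
    (hcomm : ∀ i j, Atil i * Atil j = Atil j * Atil i) :
    ∀ i j, 2 * n + (A i * A j - A j * A i).rank ≤ 2 * N := by
  intro i j
  obtain ⟨m, rfl⟩ := Nat.exists_eq_add_of_le hnN
  have hA : ∀ i p q, A i p q = Atil i (Fin.castAdd m p) (Fin.castAdd m q) := by
    intro i p q
    rw [← hext i]
    rfl
  let a : Fin d → Matrix (Fin n) (Fin m) F := fun i =>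
    (Atil i).submatrix (Fin.castAdd m) (Fin.natAdd n)
  let b : Fin d → Matrix (Fin m) (Fin n) F := fun i =>
    (Atil i).submatrix (Fin.natAdd n) (Fin.castAdd m)
  have key : A i * A j - A j * A i
      = Matrix.fromCols (a j) (-(a i)) * Matrix.fromRows (b i) (b j) := by
    rw [Matrix.fromCols_mul_fromRows]
    ext p q
    have h := congrFun (congrFun (hcomm i j) (Fin.castAdd m p)) (Fin.castAdd m q)
    simp only [Matrix.mul_apply, Fin.sum_univ_add] at h
    simp only [Matrix.sub_apply, Matrix.add_apply, Matrix.neg_mul, Matrix.neg_apply,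
      Matrix.mul_apply, hA, a, b, Matrix.submatrix_apply]
    linear_combination h
  have hr : (A i * A j - A j * A i).rank ≤ m + m := by
    rw [key]
    refine (Matrix.rank_mul_le_left _ _).trans ((Matrix.rank_le_card_width _).trans ?_)
    simp
  omega
end

section
/- Lower bound on cubature nodes (Möller-type bound): If N is the number of nodes of a positive-weight cubature rule of degree 2q+1 in d dimensions, then N ≥ C(d+q, d) + (1/2)·max_{i,j} rank([A_i, A_j]), where A_1,...,A_d are the matrix representations of the operators χ_i (multiplication by x_i followed by orthogonal projection onto P_q) in an orthonormal basis of P_q. -/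
open MeasureTheory

theorem rank_add_le_aux {m : ℕ} (B C : Matrix (Fin m) (Fin m) ℝ) :
    (B + C).rank ≤ B.rank + C.rank := by
  unfold Matrix.rank
  rw [Matrix.mulVecLin_add]
  refine le_trans (Submodule.finrank_mono ?_)
    (Submodule.finrank_add_le_finrank_add_finrank _ _)
  rintro _ ⟨x, rfl⟩
  exact Submodule.add_mem_sup ⟨x, rfl⟩ ⟨x, rfl⟩

/-- Theorem 12, Möller-type lower bound: if a positive-weight
cubature rule of degree 2q+1 in d dimensions has N nodes, then
`N ≥ C(d+q,d) + (1/2) max_{i,j} rank [A_i, A_j]`, stated as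
`2·C(d+q,d) + rank [A_i,A_j] ≤ 2N` for all i, j. -/
theorem moller_lower_bound
    (d q n N : ℕ) (hn : n = Nat.choose (d + q) d)
    (μ : Measure (Fin d → ℝ))
    (w : Fin N → ℝ) (hw : ∀ α, 0 < w α)
    (pts : Fin N → Fin d → ℝ)
    (hexact : ∀ f : MvPolynomial (Fin d) ℝ, f.totalDegree ≤ 2 * q + 1 →
      ∫ x, MvPolynomial.eval x f ∂μ = ∑ α, w α * MvPolynomial.eval (pts α) f)
    (e : Fin n → MvPolynomial (Fin d) ℝ) (hdeg : ∀ a, (e a).totalDegree ≤ q)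
    (horth : ∀ a b, ∫ x, MvPolynomial.eval x (e a) * MvPolynomial.eval x (e b) ∂μ
      = if a = b then (1 : ℝ) else 0)
    (A : Fin d → Matrix (Fin n) (Fin n) ℝ)
    (hA : ∀ i a b, A i a b
      = ∫ x, MvPolynomial.eval x (e a) * x i * MvPolynomial.eval x (e b) ∂μ) :
    ∀ i j, 2 * Nat.choose (d + q) d + (A i * A j - A j * A i).rank ≤ 2 * N := by
  rw [← hn]
  intro i j
  have h1 : ∀ a b, (∑ α, w α * (MvPolynomial.eval (pts α) (e a) * MvPolynomial.eval (pts α) (e b)))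
      = if a = b then (1 : ℝ) else 0 := by
    intro a b
    rw [← horth a b]
    have h := hexact (e a * e b) (by
      have := MvPolynomial.totalDegree_mul (e a) (e b)
      have := hdeg a
      have := hdeg b
      omega)
    simp only [map_mul] at h
    exact h.symm
  have h2 : ∀ i a b, A i a b = ∑ α, w α * (MvPolynomial.eval (pts α) (e a) * pts α i *
      MvPolynomial.eval (pts α) (e b)) := by
    intro i a b
    rw [hA i a b]
    have h := hexact (e a * MvPolynomial.X i * e b) (by
      have := MvPolynomial.totalDegree_mul (e a * MvPolynomial.X i) (e b)
      have := MvPolynomial.totalDegree_mul (e a) (MvPolynomial.X i)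
      have := MvPolynomial.totalDegree_X (R := ℝ) i
      have := hdeg a
      have := hdeg b
      omega)
    simp only [map_mul, MvPolynomial.eval_X] at h
    exact h
  let V : Matrix (Fin N) (Fin n) ℝ :=
    Matrix.of fun α a => Real.sqrt (w α) * MvPolynomial.eval (pts α) (e a)
  let D : Fin d → Matrix (Fin N) (Fin N) ℝ := fun i => Matrix.diagonal fun α => pts α i
  have hs : ∀ α, Real.sqrt (w α) * Real.sqrt (w α) = w α := fun α =>
    Real.mul_self_sqrt (hw α).le
  have hV : V.transpose * V = 1 := by
    ext a b
    rw [Matrix.mul_apply, Matrix.one_apply, ← h1 a b]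
    refine Finset.sum_congr rfl fun α _ => ?_
    simp only [V, Matrix.transpose_apply, Matrix.of_apply]
    linear_combination (MvPolynomial.eval (pts α) (e a) * MvPolynomial.eval (pts α) (e b)) * hs α
  have hAD : ∀ i, A i = V.transpose * D i * V := by
    intro i
    ext a b
    rw [Matrix.mul_apply, h2]
    refine Finset.sum_congr rfl fun α _ => ?_
    simp only [V, D, Matrix.mul_diagonal, Matrix.transpose_apply, Matrix.of_apply]
    linear_combination -(MvPolynomial.eval (pts α) (e a) * pts α i *
      MvPolynomial.eval (pts α) (e b)) * hs α
  have hD : D i * D j = D j * D i := by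
    simp only [D, Matrix.diagonal_mul_diagonal, mul_comm]
  let Q : Matrix (Fin N) (Fin N) ℝ := 1 - V * V.transpose
  have hQV : Q * V = 0 := by
    simp only [Q, Matrix.sub_mul, Matrix.mul_assoc, hV, Matrix.one_mul, Matrix.mul_one, sub_self]
  have hcomm : A i * A j - A j * A i =
      (V.transpose * D j) * Q * (D i * V) + (-(V.transpose * D i)) * Q * (D j * V) := by
    have hD' : D i * (D j * V) = D j * (D i * V) := by
      rw [← Matrix.mul_assoc, hD, Matrix.mul_assoc]
    simp only [hAD, Q, Matrix.mul_sub, Matrix.sub_mul, Matrix.mul_one, Matrix.mul_assoc,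
      Matrix.neg_mul, hD']
    abel
  have hr : (A i * A j - A j * A i).rank ≤ Q.rank + Q.rank := by
    rw [hcomm]
    refine (rank_add_le_aux _ _).trans (add_le_add ?_ ?_)
    · exact (Matrix.rank_mul_le_left _ _).trans (Matrix.rank_mul_le_right _ _)
    · exact (Matrix.rank_mul_le_left _ _).trans (Matrix.rank_mul_le_right _ _)
  have hVr : n ≤ V.rank := by
    have := Matrix.rank_mul_le_right V.transpose V
    rw [hV, Matrix.rank_one, Fintype.card_fin] at this
    exact this
  have hQr : Q.rank + V.rank ≤ N := by
    have := Matrix.rank_add_rank_le_card_of_mul_eq_zero hQV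
    simpa using this
  omega
end
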